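/- Let k be an infinite field of characteristic p ≠ 2, let m ≥ 2, and let t, n, r_1, …, r_n be positive integers with t ≤ n and, if p > 2, p not dividing r_t. Then the intersection of the k-linear span of M'_{t,n}(r_1,…,r_n) with CP(G(m)) equals the k-linear span of {u ∈ M'_{t,n}(r_1,…,r_n) : 2·lend(u) ≥ m − 1}. -/

import Mathlib

noncomputable section

/-- The `i`-th variable `x_i` of the free unital associative algebra `k⟨X⟩`. -/
def xx (k : Type*) [Field k] (i : ℕ) : FreeAlgebra k ℕ := FreeAlgebra.ι k i

/-- Commutator `[a,b] = ab - ba`. -/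
def brk {A : Type*} [Ring A] (a b : A) : A := a * b - b * a

/-- The elements of `M'_{t,n}(r_1,…,r_n)` (elements of Siderov's set `SS` whose
beginning is nonempty and contains `x_t`, whose variables lie in `{x_1,…,x_n}` and
whose degree in `x_i` is `r i`), restricted by a predicate `P` on the end length
`lend(u) = s`. -/
def MSet (k : Type*) [Field k] (t n : ℕ) (r : ℕ → ℕ) (P : ℕ → Prop) :
    Set (FreeAlgebra k ℕ) :=
  {u | ∃ (tb s : ℕ) (i : Fin tb → ℕ) (α : Fin tb → ℕ)
        (j : Fin (2 * s) → ℕ) (β : Fin (2 * s) → ℕ),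
    1 ≤ tb ∧ StrictMono i ∧ StrictMono j ∧
    (∀ a, 1 ≤ i a ∧ i a ≤ n) ∧ (∀ b, 1 ≤ j b ∧ j b ≤ n) ∧
    (∀ a b, i a ≠ j b) ∧
    (∀ a, 1 ≤ α a) ∧
    (∃ a, i a = t) ∧
    (∀ a, α a = r (i a)) ∧ (∀ b, β b + 1 = r (j b)) ∧
    (∀ v, 1 ≤ v → v ≤ n → (∃ a, i a = v) ∨ (∃ b, j b = v)) ∧
    P s ∧
    u = (List.ofFn fun a => (xx k (i a)) ^ (α a)).prod *
        (List.ofFn fun rr : Fin s =>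
          brk (xx k (j ⟨2 * rr.1, by omega⟩)) (xx k (j ⟨2 * rr.1 + 1, by omega⟩)) *
            (xx k (j ⟨2 * rr.1, by omega⟩)) ^ (β ⟨2 * rr.1, by omega⟩) *
            (xx k (j ⟨2 * rr.1 + 1, by omega⟩)) ^ (β ⟨2 * rr.1 + 1, by omega⟩)).prod}

section Exterior

variable {k : Type*} [Field k] {V : Type*} [AddCommGroup V] [Module k V]

/-- The span of all products of at least `d` vectors in the exterior algebra. -/
def degreeFiltration (k : Type*) [Field k] (V : Type*) [AddCommGroup V] [Module k V] (d : ℕ) :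
    Submodule k (ExteriorAlgebra k V) :=
  Submodule.span k {x | ∃ l : List V, d ≤ l.length ∧ x = (l.map (ExteriorAlgebra.ι k)).prod}

theorem list_map_prod_mem_degreeFiltration {d : ℕ} (l : List V) (h : d ≤ l.length) :
    (l.map (ExteriorAlgebra.ι k)).prod ∈ degreeFiltration k V d :=
  Submodule.subset_span ⟨l, h, rfl⟩

theorem mul_mem_degreeFiltration {a b : ℕ} {x y : ExteriorAlgebra k V}
    (hx : x ∈ degreeFiltration k V a) (hy : y ∈ degreeFiltration k V b) :
    x * y ∈ degreeFiltration k V (a + b) := by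
  have h := Submodule.mul_mem_mul hx hy
  rw [degreeFiltration, degreeFiltration, Submodule.span_mul_span] at h
  refine Submodule.span_mono ?_ h
  rintro _ ⟨_, ⟨l, hl, rfl⟩, _, ⟨l', hl', rfl⟩, rfl⟩
  exact ⟨l ++ l', by simp; omega, by simp⟩

theorem mem_degreeFiltration_zero (x : ExteriorAlgebra k V) : x ∈ degreeFiltration k V 0 := by
  induction x using ExteriorAlgebra.induction with
  | algebraMap c =>
    have h1 : (1 : ExteriorAlgebra k V) ∈ degreeFiltration k V 0 :=
      list_map_prod_mem_degreeFiltration [] (Nat.zero_le _)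
    rw [Algebra.algebraMap_eq_smul_one]
    exact Submodule.smul_mem _ c h1
  | ι v => simpa using list_map_prod_mem_degreeFiltration (k := k) [v] (Nat.zero_le _)
  | mul a b ha hb => simpa only [add_zero] using mul_mem_degreeFiltration ha hb
  | add a b ha hb => exact Submodule.add_mem _ ha hb

theorem mul_mem_degreeFiltration_left {d : ℕ} (x : ExteriorAlgebra k V) {y : ExteriorAlgebra k V}
    (hy : y ∈ degreeFiltration k V d) : x * y ∈ degreeFiltration k V d := by
  simpa only [zero_add] using mul_mem_degreeFiltration (mem_degreeFiltration_zero x) hy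

theorem mul_mem_degreeFiltration_right {d : ℕ} {x : ExteriorAlgebra k V}
    (hx : x ∈ degreeFiltration k V d) (y : ExteriorAlgebra k V) :
    x * y ∈ degreeFiltration k V d := by
  simpa only [add_zero] using mul_mem_degreeFiltration hx (mem_degreeFiltration_zero y)

theorem brk_mem_degreeFiltration (x y : ExteriorAlgebra k V) :
    brk x y ∈ degreeFiltration k V 2 := by
  have hx := mem_degreeFiltration_zero x
  have hy := mem_degreeFiltration_zero y
  unfold brk
  induction hx using Submodule.span_induction with
  | zero => simp
  | add a b _ _ ha hb =>
    have := Submodule.add_mem _ ha hb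
    convert this using 1
    noncomm_ring
  | smul c a _ ha =>
    have := Submodule.smul_mem _ c ha
    convert this using 1
    simp [smul_sub]
  | mem a ha =>
    obtain ⟨l, -, rfl⟩ := ha
    induction hy using Submodule.span_induction with
    | zero => simp
    | add a b _ _ ha hb =>
      have := Submodule.add_mem _ ha hb
      convert this using 1
      noncomm_ring
    | smul c a _ ha =>
      have := Submodule.smul_mem _ c ha
      convert this using 1
      simp [smul_sub]
    | mem b hb =>
      obtain ⟨l', -, rfl⟩ := hb
      rcases l with _ | ⟨v, l⟩
      · simp
      rcases l' with _ | ⟨v', l'⟩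
      · simp
      rw [← List.prod_append, ← List.prod_append, ← List.map_append, ← List.map_append]
      exact Submodule.sub_mem _
        (list_map_prod_mem_degreeFiltration _ (by simp; omega))
        (list_map_prod_mem_degreeFiltration _ (by simp; omega))

theorem list_prod_mem_degreeFiltration {d : ℕ} (l : List (ExteriorAlgebra k V))
    (h : ∀ x ∈ l, x ∈ degreeFiltration k V d) :
    l.prod ∈ degreeFiltration k V (d * l.length) := by
  induction l with
  | nil => simpa using mem_degreeFiltration_zero (k := k) (V := V) 1
  | cons a l ih =>
    have := mul_mem_degreeFiltration (h a (by simp)) (ih fun x hx => h x (by simp [hx]))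
    rw [List.prod_cons, List.length_cons]
    convert this using 2
    ring

theorem ι_mul_ι_swap (v w : V) :
    ExteriorAlgebra.ι k v * ExteriorAlgebra.ι k w =
      -(ExteriorAlgebra.ι k w * ExteriorAlgebra.ι k v) :=
  eq_neg_of_add_eq_zero_left (ExteriorAlgebra.ι_add_mul_swap v w)

theorem ι_mul_list_prod (w : V) (l : List V) :
    ExteriorAlgebra.ι k w * (l.map (ExteriorAlgebra.ι k)).prod =
      (-1) ^ l.length * ((l.map (ExteriorAlgebra.ι k)).prod * ExteriorAlgebra.ι k w) := by
  induction l with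
  | nil => simp
  | cons v l ih =>
    rw [List.map_cons, List.prod_cons, ← mul_assoc, ι_mul_ι_swap, neg_mul, mul_assoc, ih,
      List.length_cons, pow_succ]
    rcases neg_one_pow_eq_or (ExteriorAlgebra k V) l.length with h | h <;> simp [h, mul_assoc]

theorem list_prod_ι_eq_zero [Module.Finite k V] (l : List V) (hl : Module.finrank k V < l.length) :
    (l.map (ExteriorAlgebra.ι k)).prod = 0 := by
  have h : (l.map (ExteriorAlgebra.ι k)).prod = ExteriorAlgebra.ιMulti k l.length l.get := by
    rw [ExteriorAlgebra.ιMulti_apply]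
    congr 1
    apply List.ext_get <;> simp
  rw [h]
  apply AlternatingMap.map_linearDependent
  intro hli
  have := hli.fintype_card_le_finrank
  simp at this
  omega

theorem commute_of_mem_degreeFiltration [Module.Finite k V] {d : ℕ} (hd : Even d)
    (hV : Module.finrank k V - 1 ≤ d) {x : ExteriorAlgebra k V}
    (hx : x ∈ degreeFiltration k V d) (y : ExteriorAlgebra k V) : Commute x y := by
  induction hx using Submodule.span_induction with
  | zero => exact Commute.zero_left _
  | add a b _ _ ha hb => exact ha.add_left hb
  | smul c a _ ha => exact ha.smul_left c
  | mem a ha =>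
    obtain ⟨l, hl, rfl⟩ := ha
    induction y using ExteriorAlgebra.induction with
    | algebraMap c => exact (Algebra.commutes c _).symm
    | mul a b ha hb => exact ha.mul_right hb
    | add a b ha hb => exact ha.add_right hb
    | ι v =>
      rcases Nat.even_or_odd l.length with he | ho
      · rw [commute_iff_eq, ι_mul_list_prod, he.neg_one_pow, one_mul]
      · have hlt : d ≠ l.length := by
          rintro rfl
          exact (Nat.not_even_iff_odd.2 ho) hd
        have h1 := list_prod_ι_eq_zero (k := k) (v :: l) (by simp; omega)
        have h2 := list_prod_ι_eq_zero (k := k) (l ++ [v]) (by simp; omega)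
        simp only [List.map_cons, List.prod_cons, List.map_append, List.prod_append,
          List.map_nil, List.prod_nil, mul_one] at h1 h2
        rw [commute_iff_eq, h1, h2]

theorem commute_ι_mul_ι (u v w : V) :
    Commute (ExteriorAlgebra.ι k u) (ExteriorAlgebra.ι k v * ExteriorAlgebra.ι k w) := by
  rw [commute_iff_eq, ← mul_assoc, ι_mul_ι_swap u v, neg_mul, mul_assoc, ι_mul_ι_swap u w,
    mul_neg, neg_neg, mul_assoc]

theorem one_add_ι_pow (v : V) (d : ℕ) :
    (1 + ExteriorAlgebra.ι k v) ^ d = 1 + (d : k) • ExteriorAlgebra.ι k v := by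
  induction d with
  | zero => simp
  | succ d ih =>
    rw [pow_succ, ih]
    simp only [add_mul, mul_add, one_mul, mul_one, smul_mul_assoc, ExteriorAlgebra.ι_sq_zero,
      smul_zero, add_zero, Nat.cast_succ, add_smul, one_smul]
    abel

theorem brk_one_add_ι (v w : V) (a b : ℕ) :
    brk (1 + ExteriorAlgebra.ι k v) (1 + ExteriorAlgebra.ι k w) *
        (1 + ExteriorAlgebra.ι k v) ^ a * (1 + ExteriorAlgebra.ι k w) ^ b =
      (2 : k) • (ExteriorAlgebra.ι k v * ExteriorAlgebra.ι k w) := by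
  have h : brk (1 + ExteriorAlgebra.ι k v) (1 + ExteriorAlgebra.ι k w) =
      (2 : k) • (ExteriorAlgebra.ι k v * ExteriorAlgebra.ι k w) := by
    have h1 : brk (1 + ExteriorAlgebra.ι k v) (1 + ExteriorAlgebra.ι k w) =
      ExteriorAlgebra.ι k v * ExteriorAlgebra.ι k w -
        ExteriorAlgebra.ι k w * ExteriorAlgebra.ι k v := by
      unfold brk; noncomm_ring
    rw [h1, ι_mul_ι_swap w v, two_smul, sub_neg_eq_add]
  have hv : ExteriorAlgebra.ι k v * ExteriorAlgebra.ι k w * ExteriorAlgebra.ι k v = 0 := by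
    rw [mul_assoc, ι_mul_ι_swap w v, mul_neg, ← mul_assoc, ExteriorAlgebra.ι_sq_zero]; simp
  have hw : ExteriorAlgebra.ι k v * ExteriorAlgebra.ι k w * ExteriorAlgebra.ι k w = 0 := by
    rw [mul_assoc, ExteriorAlgebra.ι_sq_zero, mul_zero]
  simp [h, one_add_ι_pow, mul_add, hv, hw]

end Exterior

theorem list_prod_ofFn_smul {R A : Type*} [CommSemiring R] [Semiring A] [Algebra R A] (c : R)
    {s : ℕ} (f : Fin s → A) :
    (List.ofFn fun a => c • f a).prod = c ^ s • (List.ofFn f).prod := by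
  induction s with
  | zero => simp
  | succ s ih => simp [List.ofFn_succ, ih, smul_smul, pow_succ]

theorem list_prod_ofFn_eq_single {M : Type*} [Monoid M] {s : ℕ} (f : Fin s → M) (a : Fin s)
    (h : ∀ b, b ≠ a → f b = 1) : (List.ofFn f).prod = f a := by
  rw [List.ofFn_eq_map, List.prod_map_eq_pow_single a f fun b hb _ => h b hb,
    List.count_eq_one_of_mem (List.nodup_finRange s) (List.mem_finRange a), pow_one]

section Basis

variable (k : Type*) [Field k] (m : ℕ)

/-- The `b`-th standard generator of the exterior algebra of `k ^ m`, or zero if `m ≤ b`. -/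
def stdGen (b : ℕ) : ExteriorAlgebra k (Fin m → k) :=
  ExteriorAlgebra.ι k fun i => if i.1 = b then 1 else 0

theorem list_prod_stdGen_ne_zero {N : ℕ} (hN : N ≤ m) :
    ((List.range N).map (stdGen k m)).prod ≠ 0 := by
  have h : ((List.range N).map (stdGen k m)).prod = ExteriorAlgebra.ιMulti k N
      fun b i => if i.1 = b.1 then 1 else 0 := by
    rw [ExteriorAlgebra.ιMulti_apply]
    congr 1
    apply List.ext_get <;> simp [stdGen]
  let g : (Fin m → k) [⋀^Fin N]→ₗ[k] k :=
    (Matrix.detRowAlternating (R := k) (n := Fin N)).compLinearMap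
      (LinearMap.funLeft k k (Fin.castLE hN))
  intro h0
  rw [h] at h0
  have h1 := congrArg (ExteriorAlgebra.liftAlternating (R := k) (M := Fin m → k) (N := k)
    (Function.update (fun _ => 0) N g)) h0
  rw [ExteriorAlgebra.liftAlternating_apply_ιMulti, map_zero, Function.update_self] at h1
  have h2 : g (fun b i => if i.1 = b.1 then 1 else 0) = Matrix.det (1 : Matrix (Fin N) (Fin N) k) := by
    change Matrix.det _ = _
    congr 1
    ext a b
    simp [Matrix.one_apply, LinearMap.funLeft_apply, Fin.ext_iff, eq_comm]
  rw [h2, Matrix.det_one] at h1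
  exact one_ne_zero h1

theorem list_prod_stdGen_range (s : ℕ) :
    ((List.range (2 * s + 2)).map (stdGen k m)).prod = stdGen k m 0 * stdGen k m 1 *
      (List.ofFn fun a : Fin s => stdGen k m (2 * a.1 + 2) * stdGen k m (2 * a.1 + 1 + 2)).prod := by
  induction s with
  | zero => simp [List.range_succ]
  | succ s ih =>
    rw [show 2 * (s + 1) + 2 = (2 * s + 2) + 1 + 1 by ring, List.range_succ, List.range_succ,
      List.ofFn_succ']
    simp only [List.map_append, List.prod_append, ih, List.concat_eq_append]
    simp [mul_assoc]

end Basis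

/-- `u` is the element of Siderov's set of multidegree `r` in `x_1, …, x_n` whose beginning
contains `x_t` and whose end consists of `s` commutator factors in the variables indexed by `J`. -/
def HasEnd (k : Type*) [Field k] (t n : ℕ) (r : ℕ → ℕ) (s : ℕ) (J : Set ℕ)
    (u : FreeAlgebra k ℕ) : Prop :=
  ∃ (tb : ℕ) (i : Fin tb → ℕ) (α : Fin tb → ℕ) (j : Fin (2 * s) → ℕ) (β : Fin (2 * s) → ℕ),
    StrictMono i ∧ StrictMono j ∧ Set.range j = J ∧ J ⊆ Set.Icc 1 n ∧
    Set.range i = Set.Icc 1 n \ J ∧ (∃ a, i a = t) ∧ (∀ a, α a = r (i a)) ∧ (∀ b, β b + 1 = r (j b)) ∧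
    u = (List.ofFn fun a => (xx k (i a)) ^ (α a)).prod *
        (List.ofFn fun rr : Fin s =>
          brk (xx k (j ⟨2 * rr.1, by omega⟩)) (xx k (j ⟨2 * rr.1 + 1, by omega⟩)) *
            (xx k (j ⟨2 * rr.1, by omega⟩)) ^ (β ⟨2 * rr.1, by omega⟩) *
            (xx k (j ⟨2 * rr.1 + 1, by omega⟩)) ^ (β ⟨2 * rr.1 + 1, by omega⟩)).prod

section HasEnd

variable {k : Type*} [Field k] {t n : ℕ} {r : ℕ → ℕ}

theorem exists_hasEnd_of_mem_MSet {P : ℕ → Prop} {u : FreeAlgebra k ℕ} (hu : u ∈ MSet k t n r P) :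
    ∃ s J, P s ∧ HasEnd k t n r s J u := by
  obtain ⟨tb, s, i, α, j, β, -, hi, hj, hin, hjn, hij, -, hit, hα, hβ, hv, hP, hu⟩ := hu
  refine ⟨s, Set.range j, hP, tb, i, α, j, β, hi, hj, rfl, Set.range_subset_iff.2 hjn, ?_, hit, hα, hβ, hu⟩
  ext v
  constructor
  · rintro ⟨a, rfl⟩
    exact ⟨hin a, fun ⟨b, hb⟩ => hij a b hb.symm⟩
  · rintro ⟨⟨h1, h2⟩, h3⟩
    exact (hv v h1 h2).resolve_right fun h => h3 h

theorem HasEnd.mem_MSet {P : ℕ → Prop} {s : ℕ} {J : Set ℕ} {u : FreeAlgebra k ℕ}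
    (h : HasEnd k t n r s J u) (hr : ∀ i, 1 ≤ i → i ≤ n → 1 ≤ r i) (hs : P s) :
    u ∈ MSet k t n r P := by
  obtain ⟨tb, i, α, j, β, hi, hj, rfl, hJ, hI, hit, hα, hβ, hu⟩ := h
  have hin (a : Fin tb) : i a ∈ Set.Icc 1 n \ Set.range j := by
    rw [← hI]
    exact Set.mem_range_self a
  refine ⟨tb, s, i, α, j, β, ?_, hi, hj, fun a => (hin a).1, fun b => hJ (Set.mem_range_self b),
    fun a b hab => (hin a).2 ⟨b, hab.symm⟩, fun a => ?_, hit, hα, hβ, fun v h1 h2 => ?_, hs, hu⟩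
  · obtain ⟨a, -⟩ := hit
    exact a.pos
  · rw [hα]
    exact hr _ (hin a).1.1 (hin a).1.2
  · by_cases hv : v ∈ Set.range j
    · exact Or.inr hv
    · have : v ∈ Set.range i := hI ▸ ⟨⟨h1, h2⟩, hv⟩
      exact Or.inl this

theorem HasEnd.finite {s : ℕ} {J : Set ℕ} {u : FreeAlgebra k ℕ} (h : HasEnd k t n r s J u) :
    J.Finite := by
  obtain ⟨tb, i, α, j, β, hi, hj, rfl, -⟩ := h
  exact Set.finite_range j

theorem HasEnd.ncard_eq {s : ℕ} {J : Set ℕ} {u : FreeAlgebra k ℕ} (h : HasEnd k t n r s J u) :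
    J.ncard = 2 * s := by
  obtain ⟨tb, i, α, j, β, hi, hj, rfl, -⟩ := h
  rw [← Set.image_univ, Set.ncard_image_of_injective _ hj.injective]
  simp

theorem HasEnd.not_mem {s : ℕ} {J : Set ℕ} {u : FreeAlgebra k ℕ} (h : HasEnd k t n r s J u) :
    t ∉ J := by
  obtain ⟨tb, i, α, j, β, -, -, -, -, hI, ⟨a, rfl⟩, -⟩ := h
  have := Set.mem_range_self (f := i) a
  rw [hI] at this
  exact this.2

theorem HasEnd.eq {s s' : ℕ} {J : Set ℕ} {u u' : FreeAlgebra k ℕ} (h : HasEnd k t n r s J u)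
    (h' : HasEnd k t n r s' J u') : u = u' := by
  have hs : s = s' := by
    have := h.ncard_eq
    have := h'.ncard_eq
    omega
  subst hs
  obtain ⟨tb, i, α, j, β, hi, hj, hJ, -, hI, -, hα, hβ, rfl⟩ := h
  obtain ⟨tb', i', α', j', β', hi', hj', hJ', -, hI', -, hα', hβ', rfl⟩ := h'
  have hr : Set.range i = Set.range i' := hI.trans hI'.symm
  have htb : tb = tb' := by
    have := congrArg Set.ncard hr
    rw [← Set.image_univ, ← Set.image_univ, Set.ncard_image_of_injective _ hi.injective,
      Set.ncard_image_of_injective _ hi'.injective] at this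
    simpa using this
  subst htb
  obtain rfl := (hi.range_inj hi').1 hr
  obtain rfl := (hj.range_inj hj').1 (hJ.trans hJ'.symm)
  obtain rfl : α = α' := funext fun a => (hα a).trans (hα' a).symm
  obtain rfl : β = β' := funext fun b => by have := hβ b; have := hβ' b; omega
  rfl

theorem map_brk {A B : Type*} [Ring A] [Ring B] [Algebra k A] [Algebra k B] (φ : A →ₐ[k] B)
    (a b : A) : φ (brk a b) = brk (φ a) (φ b) := by
  simp [brk]

theorem HasEnd.map_mem_degreeFiltration {V : Type*} [AddCommGroup V] [Module k V] {s : ℕ}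
    {J : Set ℕ} {u : FreeAlgebra k ℕ} (h : HasEnd k t n r s J u)
    (φ : FreeAlgebra k ℕ →ₐ[k] ExteriorAlgebra k V) : φ u ∈ degreeFiltration k V (2 * s) := by
  obtain ⟨tb, i, α, j, β, -, -, -, -, -, -, -, -, rfl⟩ := h
  rw [map_mul]
  refine mul_mem_degreeFiltration_left _ ?_
  rw [map_list_prod, List.map_ofFn]
  have := list_prod_mem_degreeFiltration (k := k) (V := V) (d := 2) (List.ofFn (φ ∘ fun rr : Fin s =>
          brk (xx k (j ⟨2 * rr.1, by omega⟩)) (xx k (j ⟨2 * rr.1 + 1, by omega⟩)) *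
            (xx k (j ⟨2 * rr.1, by omega⟩)) ^ (β ⟨2 * rr.1, by omega⟩) *
            (xx k (j ⟨2 * rr.1 + 1, by omega⟩)) ^ (β ⟨2 * rr.1 + 1, by omega⟩))) ?_
  · rwa [List.length_ofFn] at this
  · intro x hx
    obtain ⟨a, rfl⟩ := (List.mem_ofFn' _ _).1 hx
    simp only [Function.comp_apply, map_mul, map_brk]
    exact mul_mem_degreeFiltration_right
      (mul_mem_degreeFiltration_right (brk_mem_degreeFiltration _ _) _) _

theorem HasEnd.map_eq_zero {A : Type*} [Ring A] [Algebra k A] {s : ℕ}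
    {J : Set ℕ} {u : FreeAlgebra k ℕ} (h : HasEnd k t n r s J u)
    (φ : FreeAlgebra k ℕ →ₐ[k] A) {v : ℕ} (hv : v ∈ J) (hφ : φ (xx k v) = 1) : φ u = 0 := by
  obtain ⟨tb, i, α, j, β, -, -, rfl, -, -, -, -, -, rfl⟩ := h
  obtain ⟨b, rfl⟩ := hv
  rw [map_mul, map_list_prod φ (List.ofFn fun _ : Fin s => _), List.map_ofFn]
  suffices h0 : (0 : A) ∈ List.ofFn (φ ∘ fun rr : Fin s =>
          brk (xx k (j ⟨2 * rr.1, by omega⟩)) (xx k (j ⟨2 * rr.1 + 1, by omega⟩)) *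
            (xx k (j ⟨2 * rr.1, by omega⟩)) ^ (β ⟨2 * rr.1, by omega⟩) *
            (xx k (j ⟨2 * rr.1 + 1, by omega⟩)) ^ (β ⟨2 * rr.1 + 1, by omega⟩)) by
    rw [List.prod_eq_zero h0, mul_zero]
  refine (List.mem_ofFn' _ _).2 ⟨⟨b.1 / 2, by omega⟩, ?_⟩
  simp only [Function.comp_apply, map_mul, map_brk]
  rcases Nat.even_or_odd' b.1 with ⟨c, hc | hc⟩
  · have : (⟨2 * (b.1 / 2), by omega⟩ : Fin (2 * s)) = b := by ext; simp; omega
    simp [this, hφ, brk]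
  · have : (⟨2 * (b.1 / 2) + 1, by omega⟩ : Fin (2 * s)) = b := by ext; simp; omega
    simp [this, hφ, brk]

theorem HasEnd.exists_algHom {s : ℕ} {J : Set ℕ} {u : FreeAlgebra k ℕ}
    (h : HasEnd k t n r s J u) (m : ℕ) :
    ∃ φ : FreeAlgebra k ℕ →ₐ[k] ExteriorAlgebra k (Fin m → k),
      (∀ v, v ∉ J → v ≠ t → φ (xx k v) = 1) ∧
      φ u = (1 + (r t : k) • stdGen k m 0) * ((2 : k) ^ s • (List.ofFn fun a : Fin s =>
        stdGen k m (2 * a.1 + 2) * stdGen k m (2 * a.1 + 1 + 2)).prod) := by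
  obtain ⟨tb, i, α, j, β, hi, hj, rfl, -, hI, ⟨a, ha⟩, hα, hβ, rfl⟩ := h
  have hij (a : Fin tb) : i a ∉ Set.range j := by
    have := Set.mem_range_self (f := i) a
    rw [hI] at this
    exact this.2
  let φ : FreeAlgebra k ℕ →ₐ[k] ExteriorAlgebra k (Fin m → k) :=
    FreeAlgebra.lift k (Function.extend j (fun b => 1 + stdGen k m (b.1 + 2))
      fun v => if v = t then 1 + stdGen k m 0 else 1)
  have hφj (b : Fin (2 * s)) : φ (xx k (j b)) = 1 + stdGen k m (b.1 + 2) := by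
    simp [φ, xx, hj.injective.extend_apply]
  have hφ (v : ℕ) (hv : v ∉ Set.range j) :
      φ (xx k v) = if v = t then 1 + stdGen k m 0 else 1 := by
    simp only [φ, xx, FreeAlgebra.lift_ι_apply]
    exact Function.extend_apply' _ _ _ hv
  refine ⟨φ, fun v hv hvt => by rw [hφ v hv, if_neg hvt], ?_⟩
  rw [map_mul, map_list_prod, map_list_prod, List.map_ofFn, List.map_ofFn]
  congr 1
  · rw [list_prod_ofFn_eq_single _ a]
    · rw [Function.comp_apply, map_pow, hφ _ (hij a), hα, ha, if_pos rfl]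
      exact one_add_ι_pow _ _
    · intro b hb
      have : i b ≠ t := fun h => hb (hi.injective (h.trans ha.symm))
      simp [hφ _ (hij b), this]
  · rw [← list_prod_ofFn_smul]
    congr 2
    funext b
    simp only [Function.comp_apply, map_mul, map_brk, map_pow, hφj]
    exact brk_one_add_ι _ _ _ _

end HasEnd

theorem not_commute_stdGen {k : Type*} [Field k] {m s d : ℕ} (h2 : (2 : k) ≠ 0) (hd : (d : k) ≠ 0)
    (hs : 2 * s + 2 ≤ m) {c : k} (hc : c ≠ 0) :
    ¬ Commute (c • ((1 + (d : k) • stdGen k m 0) * ((2 : k) ^ s • (List.ofFn fun a : Fin s =>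
        stdGen k m (2 * a.1 + 2) * stdGen k m (2 * a.1 + 1 + 2)).prod))) (stdGen k m 1) := by
  have hne := list_prod_stdGen_ne_zero k m hs
  rw [list_prod_stdGen_range] at hne
  have hW : Commute (stdGen k m 1) (List.ofFn fun a : Fin s =>
      stdGen k m (2 * a.1 + 2) * stdGen k m (2 * a.1 + 1 + 2)).prod := by
    refine Commute.list_prod_right _ _ fun x hx => ?_
    obtain ⟨a, rfl⟩ := (List.mem_ofFn' _ _).1 hx
    exact commute_ι_mul_ι _ _ _
  generalize (List.ofFn fun a : Fin s =>
      stdGen k m (2 * a.1 + 2) * stdGen k m (2 * a.1 + 1 + 2)).prod = W at hW hne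
  intro h
  have hswap : stdGen k m 1 * stdGen k m 0 = -(stdGen k m 0 * stdGen k m 1) := ι_mul_ι_swap _ _
  rw [commute_iff_eq, smul_mul_assoc, mul_smul_comm, mul_smul_comm, smul_mul_assoc,
    mul_smul_comm] at h
  have h := smul_right_injective _ (pow_ne_zero s h2) (smul_right_injective _ hc h)
  simp only [add_mul, one_mul, mul_add, smul_mul_assoc, mul_smul_comm, hW.eq, mul_assoc] at h
  rw [← hW.eq, add_right_inj] at h
  have h := smul_right_injective _ hd h
  simp only [← mul_assoc, hswap, neg_mul] at h
  apply hne
  have h3 : (2 : k) • (stdGen k m 0 * stdGen k m 1 * W) = 0 := by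
    rw [two_smul]
    nth_rewrite 1 [h]
    simp
  exact (smul_eq_zero.1 h3).resolve_left h2

/-- Let `k` be an infinite field of characteristic `p ≠ 2`, `m ≥ 2`,
and `t ≤ n`, `r_1, …, r_n ≥ 1` with `p ∤ r_t` when `p > 2`.  Then
`span(M'_{t,n}(r_1,…,r_n)) ∩ CP(G(m))` equals the span of those elements of
`M'_{t,n}(r_1,…,r_n)` whose end length satisfies `2·lend(u) ≥ m - 1`. -/
theorem stmt18 (k : Type*) [Field k] [Infinite k] (p : ℕ) [CharP k p] (hp : p ≠ 2)
    (m : ℕ) (hm : 2 ≤ m) (t n : ℕ) (ht : 1 ≤ t) (htn : t ≤ n) (r : ℕ → ℕ)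
    (hr : ∀ i, 1 ≤ i → i ≤ n → 1 ≤ r i) (hrt : 2 < p → ¬ p ∣ r t) :
    (↑(Submodule.span k (MSet k t n r (fun _ => True))) : Set (FreeAlgebra k ℕ)) ∩
      {f : FreeAlgebra k ℕ |
        ∀ φ : FreeAlgebra k ℕ →ₐ[k] ExteriorAlgebra k (Fin m → k),
          ∀ a, φ f * a = a * φ f} =
    ↑(Submodule.span k (MSet k t n r (fun s => m - 1 ≤ 2 * s))) := by
  have h2 : (2 : k) ≠ 0 := Ring.two_ne_zero (by rwa [ringChar.eq k p])
  have hrk : (r t : k) ≠ 0 := by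
    rw [Ne, CharP.cast_eq_zero_iff k p]
    rcases CharP.char_is_prime_or_zero k p with h | rfl
    · exact hrt (lt_of_le_of_ne h.two_le hp.symm)
    · have := hr t ht htn
      rw [zero_dvd_iff]
      omega
  apply Set.Subset.antisymm
  · rintro f ⟨hf, hc⟩
    obtain ⟨c, hcS, rfl⟩ := Submodule.mem_span_set.1 hf
    have hex : ∀ u, ∃ s J, u ∈ c.support → HasEnd k t n r s J u := fun u => by
      by_cases hu : u ∈ c.support
      · obtain ⟨s, J, -, h⟩ := exists_hasEnd_of_mem_MSet (hcS hu)
        exact ⟨s, J, fun _ => h⟩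
      · exact ⟨0, ∅, fun h => absurd h hu⟩
    choose s J hsJ using hex
    suffices hlow : ∀ u ∈ c.support, m - 1 ≤ 2 * s u by
      exact Submodule.mem_span_set.2 ⟨c, fun u hu => (hsJ u hu).mem_MSet hr (hlow u hu), rfl⟩
    by_contra! hT
    obtain ⟨u₁, hu₁, hs₁⟩ := hT
    obtain ⟨u₀, hu₀, hmin⟩ := (c.support.filter fun u => 2 * s u < m - 1).exists_min_image s
      ⟨u₁, Finset.mem_filter.2 ⟨hu₁, hs₁⟩⟩
    obtain ⟨hu₀, hs₀⟩ := Finset.mem_filter.1 hu₀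
    have h₀ := hsJ u₀ hu₀
    obtain ⟨φ, hφ, hφu⟩ := h₀.exists_algHom m
    have hzero : ∀ u ∈ c.support, u ≠ u₀ → φ u = 0 := by
      intro u hu hne
      have h := hsJ u hu
      by_cases hJ : J u ⊆ J u₀
      · have hle := Set.ncard_le_ncard hJ h₀.finite
        rw [h.ncard_eq, h₀.ncard_eq] at hle
        have hle' := hmin u (Finset.mem_filter.2 ⟨hu, by omega⟩)
        have hJe : J u = J u₀ := Set.eq_of_subset_of_ncard_le hJ
          (by rw [h.ncard_eq, h₀.ncard_eq]; omega) h₀.finite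
        rw [hJe] at h
        exact absurd (h.eq h₀) hne
      · obtain ⟨v, hv, hv₀⟩ := Set.not_subset.1 hJ
        exact h.map_eq_zero φ hv (hφ v hv₀ fun hvt => h.not_mem (hvt ▸ hv))
    have hcomm : Commute (φ (c.sum fun u a => a • u)) (stdGen k m 1) := hc φ _
    rw [Finsupp.sum, map_sum, Finset.sum_eq_single u₀
      (fun u hu hne => by rw [map_smul, hzero u hu hne, smul_zero])
      (fun h => absurd hu₀ h), map_smul, hφu] at hcomm
    exact not_commute_stdGen h2 hrk (by omega) (Finsupp.mem_support_iff.1 hu₀) hcomm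
  · intro f hf
    have hsub : MSet k t n r (fun s => m - 1 ≤ 2 * s) ⊆ MSet k t n r fun _ => True := by
      intro u hu
      obtain ⟨s, J, -, h⟩ := exists_hasEnd_of_mem_MSet hu
      exact h.mem_MSet hr trivial
    refine ⟨Submodule.span_mono hsub hf, ?_⟩
    intro φ a
    refine Submodule.span_induction (p := fun f _ => Commute (φ f) a) ?_ ?_ ?_ ?_ hf
    · intro u hu
      obtain ⟨s, J, hs, h⟩ := exists_hasEnd_of_mem_MSet hu
      exact commute_of_mem_degreeFiltration (even_two_mul s) (by simpa using hs)
        (h.map_mem_degreeFiltration φ) a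
    · simp
    · intro x y _ _ hx hy
      rw [map_add]
      exact hx.add_left hy
    · intro c x _ hx
      rw [map_smul]
      exact hx.smul_left c
end
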